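/- Let R be a commutative ring and S := R[t_1,…,t_r,ξ_1,…,ξ_r] the polynomial ring in 2r variables, made into a ℤ-graded ring by placing R in degree 0, each t_i in degree −1, and each ξ_i in degree +1. For j ∈ ℤ set S_{≤j} := ⊕_{β≤j} S_β, where S_β is the degree-β homogeneous component. Then for every integer α ≤ 0, the Koszul-type complex whose ℓ-th term (ℓ = 0,…,r) is S_{≤α−ℓ} ⊗_R Λ^ℓ(R^r) and whose differential sends s⊗ω to Σ_{i=1}^r (t_i·s)⊗(e_i∧ω) is exact, i.e. all of its cohomology vanishes (including injectivity at the leftmost term and surjectivity at the rightmost term). -/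

import Mathlib

open TensorProduct

noncomputable section

/-- Wedging on the left with a fixed vector `v`, as a linear map `⋀^ℓ M → ⋀^(ℓ+1) M`,
`ω ↦ v ∧ ω`. -/
def wedgeMap (R : Type*) [CommRing R] {M : Type*} [AddCommGroup M] [Module R M]
    (v : M) (ℓ : ℕ) : ⋀[R]^ℓ M →ₗ[R] ⋀[R]^(ℓ+1) M :=
  LinearMap.codRestrict _
    ((LinearMap.mulLeft R (ExteriorAlgebra.ι R v)).comp (Submodule.subtype _))
    (fun ω => by
      have h : ExteriorAlgebra.ι R v * (ω : ExteriorAlgebra R M) ∈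
          (LinearMap.range (ExteriorAlgebra.ι R : M →ₗ[R] ExteriorAlgebra R M)) ^ (ℓ + 1) := by
        rw [pow_succ']
        exact Submodule.mul_mem_mul (LinearMap.mem_range_self _ v) ω.2
      simpa using h)

section Contraction

variable {R M : Type*} [CommRing R] [AddCommGroup M] [Module R M]

open CliffordAlgebra in
theorem contractLeft_mem_exteriorPower (d : Module.Dual R M) (n : ℕ) (ω : ExteriorAlgebra R M)
    (hω : ω ∈ ⋀[R]^(n + 1) M) :
    contractLeft (Q := (0 : QuadraticForm R M)) d ω ∈ ⋀[R]^n M := by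
  induction n generalizing ω with
  | zero =>
    simp only [zero_add, pow_one] at hω
    obtain ⟨v, rfl⟩ := hω
    refine (contractLeft_ι (Q := (0 : QuadraticForm R M)) d v) ▸ ?_
    simp only [pow_zero]
    exact Submodule.algebraMap_mem _
  | succ n ih =>
    replace hω : ω ∈ LinearMap.range (ExteriorAlgebra.ι R : M →ₗ[R] ExteriorAlgebra R M) *
        ⋀[R]^(n + 1) M := by
      rw [← pow_succ']; exact hω
    induction hω using Submodule.mul_induction_on' with
    | mem_mul_mem a ha b hb =>
      obtain ⟨v, rfl⟩ := ha
      refine (contractLeft_ι_mul (Q := (0 : QuadraticForm R M)) d v b) ▸ ?_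
      refine Submodule.sub_mem _ (Submodule.smul_mem _ _ hb) ?_
      have := Submodule.mul_mem_mul (LinearMap.mem_range_self (ExteriorAlgebra.ι R) v) (ih b hb)
      rwa [← pow_succ'] at this
    | add x hx y hy h₁ h₂ =>
      rw [map_add]
      exact Submodule.add_mem _ h₁ h₂

/-- Contraction with a linear form `d`, as a linear map `⋀^(n+1) M → ⋀^n M`. -/
def contractMap (d : Module.Dual R M) (n : ℕ) : ⋀[R]^(n + 1) M →ₗ[R] ⋀[R]^n M :=
  (CliffordAlgebra.contractLeft (Q := (0 : QuadraticForm R M)) d).restrict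
    (contractLeft_mem_exteriorPower d n)

theorem contractMap_wedgeMap_zero (d : Module.Dual R M) (v : M) (ω : ⋀[R]^0 M) :
    contractMap d 0 (wedgeMap R v 0 ω) = d v • ω := by
  obtain ⟨ω, hω⟩ := ω
  obtain ⟨c, rfl⟩ : ∃ c : R, algebraMap R _ c = ω := by
    simpa [Submodule.mem_one] using hω
  refine Subtype.ext ?_
  refine (CliffordAlgebra.contractLeft_ι_mul (Q := (0 : QuadraticForm R M)) d v
    (algebraMap R _ c)).trans ?_
  rw [CliffordAlgebra.contractLeft_algebraMap, mul_zero, sub_zero]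
  rfl

theorem contractMap_wedgeMap (d : Module.Dual R M) (v : M) (n : ℕ) (ω : ⋀[R]^(n + 1) M) :
    contractMap d (n + 1) (wedgeMap R v (n + 1) ω) =
      d v • ω - wedgeMap R v n (contractMap d n ω) :=
  Subtype.ext (CliffordAlgebra.contractLeft_ι_mul d v _)

theorem wedgeMap_self (v : M) (n : ℕ) (ω : ⋀[R]^n M) :
    wedgeMap R v (n + 1) (wedgeMap R v n ω) = 0 := by
  refine Subtype.ext ?_
  change ExteriorAlgebra.ι R v * (ExteriorAlgebra.ι R v * (ω : ExteriorAlgebra R M)) = 0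
  rw [← mul_assoc, ExteriorAlgebra.ι_sq_zero, zero_mul]

theorem wedgeMap_add_swap (u v : M) (n : ℕ) (ω : ⋀[R]^n M) :
    wedgeMap R u (n + 1) (wedgeMap R v n ω) + wedgeMap R v (n + 1) (wedgeMap R u n ω) = 0 := by
  refine Subtype.ext ?_
  change ExteriorAlgebra.ι R u * (ExteriorAlgebra.ι R v * (ω : ExteriorAlgebra R M)) +
    ExteriorAlgebra.ι R v * (ExteriorAlgebra.ι R u * (ω : ExteriorAlgebra R M)) = 0
  rw [← mul_assoc, ← mul_assoc, ← add_mul, ExteriorAlgebra.ι_add_mul_swap, zero_mul]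

end Contraction

section Koszul

variable {R : Type*} [CommRing R] {r : ℕ} {A : ℕ → Type*} [∀ n, AddCommGroup (A n)]
  [∀ n, Module R (A n)] {T : ∀ n, Fin r → (A n →ₗ[R] A (n + 1))}
  {D : ∀ n, Fin r → (A (n + 1) →ₗ[R] A n)}
  {δ : ∀ n : ℕ, (A n ⊗[R] ⋀[R]^n (Fin r → R)) →ₗ[R] (A (n + 1) ⊗[R] ⋀[R]^(n + 1) (Fin r → R))}

theorem koszul_comp_self
    (hδ : ∀ n x ω, δ n (x ⊗ₜ[R] ω) = ∑ i, (T n i x) ⊗ₜ[R] (wedgeMap R (Pi.single i 1) n ω))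
    (hTT : ∀ n i j x, T (n + 1) i (T n j x) = T (n + 1) j (T n i x)) (n : ℕ) :
    δ (n + 1) ∘ₗ δ n = 0 := by
  refine TensorProduct.ext' fun x ω => ?_
  simp only [LinearMap.comp_apply, hδ, map_sum, LinearMap.zero_apply]
  rw [← Finset.sum_product']
  refine Finset.sum_involution (fun a _ => (a.2, a.1)) ?_ ?_ (by simp) (by simp)
  · rintro ⟨i, j⟩ -
    dsimp only
    rw [hTT n i j, ← TensorProduct.tmul_add, wedgeMap_add_swap, TensorProduct.tmul_zero]
  · rintro ⟨i, j⟩ - h he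
    obtain rfl : j = i := congrArg Prod.fst he
    exact h (by rw [wedgeMap_self, TensorProduct.tmul_zero])

/-- The homotopy attached to the `i`-th coordinate: divide by `tᵢ` and contract with the `i`-th
coordinate form. -/
def koszulHomotopy (D : ∀ n, Fin r → (A (n + 1) →ₗ[R] A n)) (i : Fin r) (n : ℕ) :
    (A (n + 1) ⊗[R] ⋀[R]^(n + 1) (Fin r → R)) →ₗ[R] (A n ⊗[R] ⋀[R]^n (Fin r → R)) :=
  TensorProduct.map (D n i) (contractMap (LinearMap.proj i) n)

/-- The endomorphism of the Koszul complex that `koszulHomotopy` connects to the identity. -/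
def koszulProj (T : ∀ n, Fin r → (A n →ₗ[R] A (n + 1)))
    (D : ∀ n, Fin r → (A (n + 1) →ₗ[R] A n)) (n : ℕ) (i : Fin r) :
    Module.End R (A (n + 1) ⊗[R] ⋀[R]^(n + 1) (Fin r → R)) :=
  TensorProduct.map (1 - T n i ∘ₗ D n i)
    (wedgeMap R (Pi.single i 1) n ∘ₗ contractMap (LinearMap.proj i) n)

theorem koszulHomotopy_zero_comp
    (hδ : ∀ n x ω, δ n (x ⊗ₜ[R] ω) = ∑ i, (T n i x) ⊗ₜ[R] (wedgeMap R (Pi.single i 1) n ω))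
    (hDT : ∀ n i x, D n i (T n i x) = x) (i : Fin r) :
    koszulHomotopy D i 0 ∘ₗ δ 0 = LinearMap.id := by
  refine TensorProduct.ext' fun x ω => ?_
  simp only [LinearMap.comp_apply, hδ, map_sum, koszulHomotopy, TensorProduct.map_tmul,
    contractMap_wedgeMap_zero, LinearMap.proj_apply, LinearMap.id_apply]
  rw [Finset.sum_eq_single i (fun j _ hj => by rw [Pi.single_eq_of_ne hj.symm, zero_smul,
    TensorProduct.tmul_zero]) (by simp), Pi.single_eq_same, one_smul, hDT]

theorem koszulHomotopy_comp_add
    (hδ : ∀ n x ω, δ n (x ⊗ₜ[R] ω) = ∑ i, (T n i x) ⊗ₜ[R] (wedgeMap R (Pi.single i 1) n ω))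
    (hDT : ∀ n i x, D n i (T n i x) = x)
    (hDT' : ∀ n i j x, i ≠ j → D (n + 1) i (T (n + 1) j x) = T n j (D n i x))
    (i : Fin r) (n : ℕ) :
    δ n ∘ₗ koszulHomotopy D i n + koszulHomotopy D i (n + 1) ∘ₗ δ (n + 1) =
      1 - koszulProj T D n i := by
  refine TensorProduct.ext' fun x ω => ?_
  simp only [LinearMap.add_apply, LinearMap.sub_apply, LinearMap.comp_apply, hδ, map_sum,
    koszulHomotopy, koszulProj, TensorProduct.map_tmul, contractMap_wedgeMap,
    LinearMap.proj_apply, Module.End.one_apply]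
  rw [← Finset.sum_add_distrib, Finset.sum_eq_single i]
  · rw [hDT, Pi.single_eq_same, one_smul, TensorProduct.tmul_sub, TensorProduct.sub_tmul]
    abel
  · intro j _ hj
    rw [hDT' n i j x hj.symm, Pi.single_eq_of_ne hj.symm, zero_smul, ← TensorProduct.tmul_add,
      zero_sub, add_neg_cancel, TensorProduct.tmul_zero]
  · simp

/-- A Koszul-type complex in which each `tᵢ` has a left inverse `Dᵢ` commuting with the other
`tⱼ`, and in which the product of the projections `1 - tᵢDᵢ` vanishes, is exact. -/
theorem koszul_exact
    (hδ : ∀ n x ω, δ n (x ⊗ₜ[R] ω) = ∑ i, (T n i x) ⊗ₜ[R] (wedgeMap R (Pi.single i 1) n ω))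
    (hr : 1 ≤ r)
    (hTT : ∀ n i j x, T (n + 1) i (T n j x) = T (n + 1) j (T n i x))
    (hDT : ∀ n i x, D n i (T n i x) = x)
    (hDT' : ∀ n i j x, i ≠ j → D (n + 1) i (T (n + 1) j x) = T n j (D n i x))
    (hprod : ∀ n, ((List.finRange r).map fun i =>
      (1 - T n i ∘ₗ D n i : Module.End R (A (n + 1)))).prod = 0) :
    LinearMap.ker (δ 0) = ⊥ ∧ ∀ n : ℕ, LinearMap.ker (δ (n + 1)) = LinearMap.range (δ n) := by
  refine ⟨LinearMap.ker_eq_bot_of_inverse (koszulHomotopy_zero_comp hδ hDT ⟨0, hr⟩),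
    fun n => le_antisymm (fun x hx => ?_)
      (LinearMap.range_le_ker_iff.2 (koszul_comp_self hδ hTT n))⟩
  have hsub : ∀ l : List (Fin r),
      x - (l.map (koszulProj T D n)).prod x ∈ LinearMap.range (δ n) := by
    intro l
    induction l with
    | nil => simp
    | cons i l ih =>
      set y := (l.map (koszulProj T D n)).prod x
      have hy : δ (n + 1) y = 0 := by
        have h := LinearMap.range_le_ker_iff.2 (koszul_comp_self hδ hTT n) ih
        rw [LinearMap.mem_ker, map_sub, LinearMap.mem_ker.1 hx, zero_sub, neg_eq_zero] at h
        exact h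
      have h := LinearMap.congr_fun (koszulHomotopy_comp_add hδ hDT hDT' i n) y
      simp only [LinearMap.add_apply, LinearMap.comp_apply, hy, map_zero, add_zero,
        LinearMap.sub_apply, Module.End.one_apply] at h
      rw [List.map_cons, List.prod_cons, Module.End.mul_apply, ← sub_add_sub_cancel x y, ← h]
      exact Submodule.add_mem _ ih (LinearMap.mem_range_self _ _)
  have hmap : ∀ l : List (Fin r), (l.map (koszulProj T D n)).prod =
      TensorProduct.map (l.map fun i => (1 - T n i ∘ₗ D n i : Module.End R (A (n + 1)))).prod
        (l.map fun i => (wedgeMap R (Pi.single i 1) n ∘ₗ contractMap (LinearMap.proj i) n :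
          Module.End R (⋀[R]^(n + 1) (Fin r → R)))).prod := by
    intro l
    induction l with
    | nil => simp [TensorProduct.map_one]
    | cons i l ih =>
      simp only [List.map_cons, List.prod_cons, ih, TensorProduct.map_mul]
      rfl
  simpa [hmap, hprod] using hsub (List.finRange r)

end Koszul

section Polynomial

open MvPolynomial

variable {R σ : Type*} [CommRing R]

theorem mem_iSup_weightedHomogeneousSubmodule_iff (w : σ → ℤ) (j : ℤ) (p : MvPolynomial σ R) :
    p ∈ ⨆ β ≤ j, weightedHomogeneousSubmodule R w β ↔
      ∀ m, coeff m p ≠ 0 → Finsupp.weight w m ≤ j := by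
  constructor
  · intro hp
    let N : Submodule R (MvPolynomial σ R) :=
      { carrier := {p | ∀ m, j < Finsupp.weight w m → coeff m p = 0}
        zero_mem' := by simp
        add_mem' := fun {a b} ha hb m hm => by simp [ha m hm, hb m hm]
        smul_mem' := fun c a ha m hm => by simp [ha m hm] }
    have hN : ⨆ β ≤ j, weightedHomogeneousSubmodule R w β ≤ N := by
      refine iSup₂_le fun β hβ q hq m hm => ?_
      by_contra h
      exact absurd (((mem_weightedHomogeneousSubmodule R w β q).1 hq) h) (by omega)
    intro m hm
    by_contra! h
    exact hm (hN hp m h)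
  · intro h
    rw [p.as_sum]
    refine Submodule.sum_mem _ fun m hm => ?_
    refine Submodule.mem_iSup_of_mem _ (Submodule.mem_iSup_of_mem (h m (mem_support_iff.1 hm)) ?_)
    exact isWeightedHomogeneous_monomial w m _ rfl

variable (R) in
/-- Division by the variable `X i`, discarding the monomials not divisible by it. -/
def divX (i : σ) : MvPolynomial σ R →ₗ[R] MvPolynomial σ R where
  toFun p := p.divMonomial (Finsupp.single i 1)
  map_add' p q := by ext; simp
  map_smul' c p := by ext; simp

theorem coeff_divX (i : σ) (p : MvPolynomial σ R) (m : σ →₀ ℕ) :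
    coeff m (divX R i p) = coeff (Finsupp.single i 1 + m) p :=
  coeff_divMonomial _ _ _

theorem divX_X_mul (i : σ) (p : MvPolynomial σ R) : divX R i (X i * p) = p := by
  ext m
  rw [coeff_divX, coeff_X_mul]

theorem divX_X_mul_of_ne {i j : σ} (h : i ≠ j) (p : MvPolynomial σ R) :
    divX R i (X j * p) = X j * divX R i p := by
  classical
  ext m
  rw [coeff_divX, coeff_X_mul', coeff_X_mul', coeff_divX]
  have : j ∈ (Finsupp.single i 1 + m).support ↔ j ∈ m.support := by
    simp [Finsupp.single_eq_of_ne h.symm]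
  simp only [this]
  split_ifs with hj
  · congr 1
    rw [add_tsub_assoc_of_le]
    simpa [Nat.one_le_iff_ne_zero] using hj
  · rfl

theorem coeff_sub_X_mul_divX (i : σ) (p : MvPolynomial σ R) (m : σ →₀ ℕ) :
    coeff m (p - X i * divX R i p) = if m i = 0 then coeff m p else 0 := by
  classical
  rw [coeff_sub, coeff_X_mul', coeff_divX]
  by_cases h : m i = 0
  · simp [h]
  · rw [if_pos (by simpa using h), if_neg h, add_tsub_cancel_of_le, sub_self]
    simpa [Nat.one_le_iff_ne_zero] using h

end Polynomial

/-- Let `R` be a commutative ring and `S = R[t_1, …, t_r, ξ_1, …, ξ_r]`,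
`ℤ`-graded with `R` in degree `0`, `deg tᵢ = -1`, `deg ξᵢ = +1` (the variables are indexed
by `Fin r ⊕ Fin r`, with `Sum.inl i ↦ tᵢ` and `Sum.inr i ↦ ξᵢ`).  For `j ∈ ℤ`, let
`S_{≤j} = ⊕_{β ≤ j} S_β`.  Then for every integer `α ≤ 0` the Koszul-type complex with
`ℓ`-th term `S_{≤ α-ℓ} ⊗_R Λ^ℓ(R^r)` and differential `s ⊗ ω ↦ Σᵢ (tᵢ·s) ⊗ (eᵢ ∧ ω)` is
exact, including injectivity at the leftmost term (`ker (δ 0) = ⊥`) and surjectivity at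
the rightmost term (the case `n = r - 1` of `ker (δ (n+1)) = range (δ n)`, since the
`(r+1)`-st term vanishes). -/
theorem statement5 (R : Type*) [CommRing R] (r : ℕ) (hr : 1 ≤ r)
    (w : Fin r ⊕ Fin r → ℤ)
    (hw : w = Sum.elim (fun _ => (-1 : ℤ)) (fun _ => (1 : ℤ)))
    (Sle : ℤ → Submodule R (MvPolynomial (Fin r ⊕ Fin r) R))
    (hSle : ∀ j : ℤ, Sle j =
      ⨆ β ≤ j, MvPolynomial.weightedHomogeneousSubmodule R w β)
    (α : ℤ) (hα : α ≤ 0)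
    (T : ∀ (n : ℕ), Fin r → (Sle (α - n) →ₗ[R] Sle (α - (n + 1 : ℕ))))
    (hT : ∀ (n : ℕ) (i : Fin r) (s : MvPolynomial (Fin r ⊕ Fin r) R)
        (hs : s ∈ Sle (α - n))
        (hs' : MvPolynomial.X (Sum.inl i) * s ∈ Sle (α - (n + 1 : ℕ))),
      T n i ⟨s, hs⟩ = ⟨MvPolynomial.X (Sum.inl i) * s, hs'⟩)
    (δ : ∀ n : ℕ, (Sle (α - n) ⊗[R] ⋀[R]^n (Fin r → R)) →ₗ[R]
        (Sle (α - (n + 1 : ℕ)) ⊗[R] ⋀[R]^(n+1) (Fin r → R)))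
    (hδ : ∀ (n : ℕ) (x : Sle (α - n)) (ω : ⋀[R]^n (Fin r → R)),
      δ n (x ⊗ₜ[R] ω) = ∑ i, (T n i x) ⊗ₜ[R] (wedgeMap R (Pi.single i 1) n ω)) :
    LinearMap.ker (δ 0) = ⊥ ∧
    ∀ n : ℕ, LinearMap.ker (δ (n+1)) = LinearMap.range (δ n) := by

  have hmem : ∀ j p, p ∈ Sle j ↔ ∀ m, MvPolynomial.coeff m p ≠ 0 → Finsupp.weight w m ≤ j :=
    fun j p => by rw [hSle, mem_iSup_weightedHomogeneousSubmodule_iff]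
  have hX : ∀ (n : ℕ) (i : Fin r), ∀ s ∈ Sle (α - n),
      MvPolynomial.X (Sum.inl i) * s ∈ Sle (α - (n + 1 : ℕ)) := by
    intro n i s hs
    rw [hmem] at hs ⊢
    intro m hm
    classical
    rw [MvPolynomial.coeff_X_mul'] at hm
    split_ifs at hm with hi
    · have hle : Finsupp.single (Sum.inl i) 1 ≤ m := by
        simpa [Nat.one_le_iff_ne_zero] using hi
      have h := hs _ hm
      rw [← tsub_add_cancel_of_le hle, map_add, Finsupp.weight_single]
      simp only [hw, Sum.elim_inl, one_smul, Nat.cast_add, Nat.cast_one] at h ⊢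
      linarith
    · exact absurd rfl hm
  have hTc : ∀ (n : ℕ) i (x : Sle (α - n)), (T n i x : MvPolynomial (Fin r ⊕ Fin r) R) =
      MvPolynomial.X (Sum.inl i) * x.1 := fun n i x =>
    congrArg Subtype.val (hT n i x.1 x.2 (hX n i x.1 x.2))
  have hD : ∀ (n : ℕ) (i : Fin r), ∀ s ∈ Sle (α - (n + 1 : ℕ)),
      divX R (Sum.inl i) s ∈ Sle (α - n) := by
    intro n i s hs
    rw [hmem] at hs ⊢
    intro m hm
    rw [coeff_divX] at hm
    have h := hs _ hm
    rw [map_add, Finsupp.weight_single] at h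
    simp only [hw, Sum.elim_inl, one_smul, Nat.cast_add, Nat.cast_one] at h ⊢
    linarith
  refine koszul_exact (A := fun n : ℕ => Sle (α - n)) (T := T)
    (D := fun n i => (divX R (Sum.inl i)).restrict (hD n i)) hδ hr ?_ ?_ ?_ ?_
  · intro n i j x
    refine Subtype.ext ?_
    rw [hTc, hTc, hTc, hTc, mul_left_comm]
  · intro n i x
    refine Subtype.ext ?_
    rw [LinearMap.coe_restrict_apply, hTc, divX_X_mul]
  · intro n i j x hij
    refine Subtype.ext ?_
    rw [LinearMap.coe_restrict_apply, hTc, hTc, LinearMap.coe_restrict_apply,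
      divX_X_mul_of_ne (Sum.inl_injective.ne hij)]
  · intro n
    have hcoeff : ∀ (l : List (Fin r)) (x : Sle (α - (n + 1 : ℕ))) (m : Fin r ⊕ Fin r →₀ ℕ),
        MvPolynomial.coeff m ((l.map fun i => (1 - T n i ∘ₗ (divX R (Sum.inl i)).restrict (hD n i) :
          Module.End R (Sle (α - (n + 1 : ℕ))))).prod x : MvPolynomial (Fin r ⊕ Fin r) R) =
        if ∀ i ∈ l, m (Sum.inl i) = 0 then MvPolynomial.coeff m x.1 else 0 := by
      intro l x m
      induction l with
      | nil => simp
      | cons i l ih =>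
        rw [List.map_cons, List.prod_cons, Module.End.mul_apply, LinearMap.sub_apply,
          Module.End.one_apply, LinearMap.comp_apply, Submodule.coe_sub, hTc,
          LinearMap.coe_restrict_apply, coeff_sub_X_mul_divX, ih, ← ite_and]
        simp only [List.forall_mem_cons]
    refine LinearMap.ext fun x => Subtype.ext (MvPolynomial.ext _ _ fun m => ?_)
    rw [hcoeff, LinearMap.zero_apply, Submodule.coe_zero, MvPolynomial.coeff_zero]
    split_ifs with hm
    · by_contra h
      have hle := (hmem _ _).1 x.2 m h
      have hnonneg : 0 ≤ Finsupp.weight w m := by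
        rw [Finsupp.weight_apply, Finsupp.sum_fintype _ _ (by simp), Fintype.sum_sum_type]
        simp [hw, hm, Finset.sum_nonneg]
      push_cast at hle
      linarith
    · rfl
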